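/- Let b ≥ 2 and α ≥ 2 be integers. Then ω_α(0) = ∑_{k=1}^{∞} r_α(k) = ∑_{r=1}^{α−1} ∏_{i=1}^{r} (b−1)/(b^i − 1) + (b−1)/(b^α − b) · ∏_{i=1}^{α−1} (b−1)/(b^i − 1), and in particular the series ∑_{k≥1} r_α(k) converges. -/

import Mathlib

open scoped BigOperators
open scoped Classical

noncomputable section

/-- The `i`-th base-`b` digit (for `i ≥ 1`) of a real `x` (intended `x ∈ [0,1)`),
using the expansion that does not end in infinitely many digits `b-1`. -/
def xdigit (b : ℕ) (x : ℝ) (i : ℕ) : ℕ := (⌊x * (b : ℝ) ^ i⌋).toNat % b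

/-- The `i`-th base-`b` digit of a natural number `k`. -/
def ndigit (b k i : ℕ) : ℕ := k / b ^ i % b

/-- The `k`-th Walsh function in base `b`:
`wal_k(x) = exp(2πi (ξ_1 κ_0 + ξ_2 κ_1 + ⋯)/b)`. -/
def wal (b k : ℕ) (x : ℝ) : ℂ :=
  Complex.exp (2 * (Real.pi : ℂ) * Complex.I / (b : ℂ) *
    ∑ i ∈ Finset.range (k + 1), (ndigit b k i : ℂ) * (xdigit b x (i + 1) : ℂ))

/-- The set of positions of nonzero base-`b` digits of `k`. -/
def nzset (b k : ℕ) : Finset ℕ :=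
  (Finset.range (k + 1)).filter fun i => ndigit b k i ≠ 0

/-- The (at most) `α` largest nonzero-digit positions of `k` in base `b`. -/
def topPos (b α k : ℕ) : Finset ℕ :=
  (nzset b k).filter fun a => ((nzset b k).filter fun y => a < y).card < α

/-- `r_α(k) = b^{-∑_{i=1}^{min(#k,α)} (a_i + 1)}`, where `a_1 > a_2 > ⋯` are the positions of
the nonzero base-`b` digits of `k`; `r_α(0) = 1`. -/
def ralpha (b α k : ℕ) : ℝ := ((b : ℝ) ^ (∑ a ∈ topPos b α k, (a + 1)))⁻¹

/-- `r_α(γ, k) = ∏_{j : k_j ≠ 0} γ_j r_α(k_j)` (weights indexed from `0`). -/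
def rvec (b α : ℕ) (γ : ℕ → ℝ) {s : ℕ} (k : Fin s → ℕ) : ℝ :=
  ∏ j, if k j = 0 then 1 else γ (j : ℕ) * ralpha b α (k j)

/-- `ω_α(x) = ∑_{k=1}^∞ r_α(k) wal_k(x)`. -/
def omegaF (b α : ℕ) (x : ℝ) : ℂ :=
  ∑' k : ℕ, (ralpha b α (k + 1) : ℂ) * wal b (k + 1) x

lemma mem_nzset {b k i : ℕ} (hb : 2 ≤ b) : i ∈ nzset b k ↔ k / b ^ i % b ≠ 0 := by
  rw [nzset, Finset.mem_filter, Finset.mem_range, ndigit, and_iff_right_iff_imp]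
  intro h
  by_contra! hi
  have h1 : k < b ^ i := lt_of_lt_of_le (by omega) (Nat.lt_pow_self (by omega : 1 < b)).le
  simp [Nat.div_eq_of_lt h1] at h

lemma lt_of_mem_nzset {b k m i : ℕ} (hb : 2 ≤ b) (hk : k < b ^ m) (hi : i ∈ nzset b k) :
    i < m := by
  rw [mem_nzset hb] at hi
  by_contra! h
  have h1 : k < b ^ i := lt_of_lt_of_le hk (Nat.pow_le_pow_right (by omega) h)
  simp [Nat.div_eq_of_lt h1] at hi

lemma nzset_mul_pow_add {b m κ k : ℕ} (hb : 2 ≤ b) (hκ : 0 < κ) (hκb : κ < b)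
    (hk : k < b ^ m) : nzset b (κ * b ^ m + k) = insert m (nzset b k) := by
  have hb0 : 0 < b := by omega
  ext i
  rw [Finset.mem_insert, mem_nzset hb, mem_nzset hb]
  rcases lt_trichotomy i m with h | rfl | h
  · obtain ⟨d, rfl⟩ := Nat.exists_eq_add_of_lt h
    have e : κ * b ^ (i + d + 1) + k = b ^ i * (b * (κ * b ^ d)) + k := by ring
    rw [e, Nat.mul_add_div (pow_pos hb0 i), Nat.mul_add_mod]
    simp [h.ne]
  · have e : κ * b ^ i + k = b ^ i * κ + k := by ring
    rw [e, Nat.mul_add_div (pow_pos hb0 i), Nat.div_eq_of_lt hk, add_zero, Nat.mod_eq_of_lt hκb]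
    simp [hκ.ne']
  · have h2 : b ^ (m + 1) ≤ b ^ i := Nat.pow_le_pow_right hb0 h
    have h1 : κ * b ^ m + k < b ^ i := by
      have : (κ + 1) * b ^ m ≤ b * b ^ m := Nat.mul_le_mul_right _ hκb
      rw [pow_succ] at h2
      nlinarith
    have h3 : k < b ^ i := by nlinarith
    simp [Nat.div_eq_of_lt h1, Nat.div_eq_of_lt h3, h.ne']

lemma topPos_mul_pow_add {b m κ k : ℕ} (α : ℕ) (hb : 2 ≤ b) (hκ : 0 < κ) (hκb : κ < b)
    (hk : k < b ^ m) : topPos b (α + 1) (κ * b ^ m + k) = insert m (topPos b α k) := by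
  have hlt : ∀ i ∈ nzset b k, i < m := fun i hi => lt_of_mem_nzset hb hk hi
  unfold topPos
  rw [nzset_mul_pow_add hb hκ hκb hk, Finset.filter_insert, if_pos]
  · congr 1
    refine Finset.filter_congr fun i hi => ?_
    rw [Finset.filter_insert, if_pos (hlt i hi), Finset.card_insert_of_notMem]
    · omega
    · intro h
      exact (hlt m (Finset.mem_filter.1 h).1).false
  · rw [Finset.filter_insert, if_neg (lt_irrefl m), Finset.filter_false_of_mem]
    · simp
    · intro i hi
      exact (hlt i hi).le.not_gt

lemma ralpha_mul_pow_add {b m κ k : ℕ} (α : ℕ) (hb : 2 ≤ b) (hκ : 0 < κ) (hκb : κ < b)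
    (hk : k < b ^ m) :
    ralpha b (α + 1) (κ * b ^ m + k) = ((b : ℝ) ^ (m + 1))⁻¹ * ralpha b α k := by
  unfold ralpha
  rw [topPos_mul_pow_add α hb hκ hκb hk, Finset.sum_insert, pow_add, mul_inv]
  intro h
  exact (lt_of_mem_nzset hb hk (Finset.mem_filter.1 h).1).false

lemma ralpha_nonneg (b α k : ℕ) : 0 ≤ ralpha b α k := by
  unfold ralpha
  positivity

lemma ralpha_zero_left (b k : ℕ) : ralpha b 0 k = 1 := by
  simp [ralpha, topPos]

lemma ralpha_zero_right (b α : ℕ) : ralpha b α 0 = 1 := by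
  simp [ralpha, topPos, nzset, ndigit]

/-- The sum of `r_α(k)` over all `k` with at most `m` base-`b` digits. -/
def blockSum (b α m : ℕ) : ℝ := ∑ k ∈ Finset.range (b ^ m), ralpha b α k

lemma blockSum_nonneg (b α m : ℕ) : 0 ≤ blockSum b α m :=
  Finset.sum_nonneg fun _ _ => ralpha_nonneg _ _ _

lemma blockSum_zero_left (b m : ℕ) : blockSum b 0 m = (b : ℝ) ^ m := by
  simp [blockSum, ralpha_zero_left]

lemma blockSum_zero_right (b α : ℕ) : blockSum b α 0 = 1 := by
  simp [blockSum, ralpha_zero_right]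

lemma sum_ralpha_range_mul_pow {b : ℕ} (α m c : ℕ) (hb : 2 ≤ b) (hc : c < b) :
    ∑ k ∈ Finset.range ((c + 1) * b ^ m), ralpha b (α + 1) k =
      blockSum b (α + 1) m + c * ((b : ℝ) ^ (m + 1))⁻¹ * blockSum b α m := by
  induction c with
  | zero => simp [blockSum]
  | succ c ih =>
    rw [add_mul (c + 1), one_mul, Finset.sum_range_add, ih (by omega),
      Finset.sum_congr rfl fun k hk =>
        ralpha_mul_pow_add α hb c.succ_pos hc (Finset.mem_range.1 hk),
      ← Finset.mul_sum, blockSum, blockSum]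
    push_cast
    ring

lemma blockSum_succ {b : ℕ} (α m : ℕ) (hb : 2 ≤ b) :
    blockSum b (α + 1) (m + 1) = blockSum b (α + 1) m +
      ((b : ℝ) - 1) * ((b : ℝ) ^ (m + 1))⁻¹ * blockSum b α m := by
  have h := sum_ralpha_range_mul_pow α m (b - 1) hb (by omega)
  rw [Nat.sub_add_cancel (by omega : 1 ≤ b), ← pow_succ', Nat.cast_sub (by omega : 1 ≤ b)] at h
  simpa [blockSum] using h

lemma blockSum_succ_left_le {b : ℕ} (α m : ℕ) (hb : 2 ≤ b) :
    blockSum b (α + 1) m ≤ m + 1 := by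
  have hb' : (2 : ℝ) ≤ b := by exact_mod_cast hb
  induction α generalizing m with
  | zero =>
    induction m with
    | zero => simp [blockSum_zero_right]
    | succ m ih =>
      rw [blockSum_succ 0 m hb, blockSum_zero_left]
      have h : ((b : ℝ) - 1) * ((b : ℝ) ^ (m + 1))⁻¹ * (b : ℝ) ^ m ≤ 1 := by
        rw [pow_succ]
        have : ((b : ℝ) - 1) * ((b : ℝ) ^ m * b)⁻¹ * (b : ℝ) ^ m = ((b : ℝ) - 1) / b := by
          field_simp
        rw [this, div_le_one (by linarith)]
        linarith
      push_cast
      linarith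
  | succ α ihα =>
    induction m with
    | zero => simp [blockSum_zero_right]
    | succ m ih =>
      rw [blockSum_succ (α + 1) m hb]
      have hm : blockSum b (α + 1) m ≤ (b : ℝ) ^ m := by
        refine (ihα m).trans ?_
        exact_mod_cast Nat.lt_pow_self (by omega : 1 < b)
      have h : ((b : ℝ) - 1) * ((b : ℝ) ^ (m + 1))⁻¹ * blockSum b (α + 1) m ≤ 1 := by
        rw [mul_assoc, inv_mul_eq_div, mul_div_assoc', div_le_one (by positivity), pow_succ']
        exact mul_le_mul (by linarith) hm (blockSum_nonneg _ _ _) (by linarith)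
      push_cast
      linarith

lemma summable_blockSum {b : ℕ} (n j : ℕ) (hb : 2 ≤ b) (hj : 1 ≤ j) (hnj : 2 ≤ n + j) :
    Summable fun m => (((b : ℝ) ^ j)⁻¹) ^ m * blockSum b n m := by
  have hb' : (2 : ℝ) ≤ b := by exact_mod_cast hb
  cases n with
  | zero =>
    obtain ⟨i, rfl⟩ := Nat.exists_eq_add_of_le' hj
    have h : (fun m => (((b : ℝ) ^ (i + 1))⁻¹) ^ m * blockSum b 0 m) =
        fun m => (((b : ℝ) ^ i)⁻¹) ^ m := by
      ext m
      rw [blockSum_zero_left, ← mul_pow]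
      congr 1
      rw [pow_succ]
      field_simp
    rw [h]
    exact summable_geometric_of_lt_one (by positivity)
      (inv_lt_one_of_one_lt₀ (one_lt_pow₀ (by linarith) (by omega)))
  | succ n =>
    have hz : ((b : ℝ) ^ j)⁻¹ < 1 :=
      inv_lt_one_of_one_lt₀ (one_lt_pow₀ (by linarith) (by omega))
    have hz0 : 0 ≤ ((b : ℝ) ^ j)⁻¹ := by positivity
    have hs : Summable fun m : ℕ => (((b : ℝ) ^ j)⁻¹) ^ m * ((m : ℝ) + 1) := by
      have h1 := summable_pow_mul_geometric_of_norm_lt_one (R := ℝ) 1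
        (r := ((b : ℝ) ^ j)⁻¹) (by rwa [Real.norm_of_nonneg hz0])
      refine (h1.add (summable_geometric_of_lt_one hz0 hz)).congr fun m => ?_
      ring
    refine Summable.of_nonneg_of_le
      (fun m => mul_nonneg (by positivity) (blockSum_nonneg _ _ _)) (fun m => ?_) hs
    exact mul_le_mul_of_nonneg_left (blockSum_succ_left_le n m hb) (by positivity)

lemma tsum_blockSum_succ {b : ℕ} (n j : ℕ) (hb : 2 ≤ b) (hj : 1 ≤ j) :
    (1 - ((b : ℝ) ^ j)⁻¹) * ∑' m, (((b : ℝ) ^ j)⁻¹) ^ m * blockSum b (n + 1) m =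
      1 + ((b : ℝ) - 1) * ((b : ℝ) ^ (j + 1))⁻¹ *
        ∑' m, (((b : ℝ) ^ (j + 1))⁻¹) ^ m * blockSum b n m := by
  have hb' : (2 : ℝ) ≤ b := by exact_mod_cast hb
  have hs := summable_blockSum (n + 1) j hb hj (by omega)
  have hs' := summable_blockSum n (j + 1) hb (by omega) (by omega)
  have e : ∀ m, (((b : ℝ) ^ j)⁻¹) ^ (m + 1) * blockSum b (n + 1) (m + 1) =
      ((b : ℝ) ^ j)⁻¹ * ((((b : ℝ) ^ j)⁻¹) ^ m * blockSum b (n + 1) m) +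
      (((b : ℝ) - 1) * ((b : ℝ) ^ (j + 1))⁻¹) *
        ((((b : ℝ) ^ (j + 1))⁻¹) ^ m * blockSum b n m) := by
    intro m
    rw [blockSum_succ n m hb]
    simp only [pow_succ, mul_pow, mul_inv]
    ring
  have h := hs.tsum_eq_zero_add
  rw [tsum_congr e, (hs.mul_left _).tsum_add (hs'.mul_left _), tsum_mul_left, tsum_mul_left,
    blockSum_zero_right, pow_zero, one_mul] at h
  linear_combination h

lemma tsum_blockSum {b : ℕ} (n j : ℕ) (hb : 2 ≤ b) (hj : 1 ≤ j) (hnj : 2 ≤ n + j) :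
    (1 - ((b : ℝ) ^ j)⁻¹) * ∑' m, (((b : ℝ) ^ j)⁻¹) ^ m * blockSum b n m =
      ∑ r ∈ Finset.range n, ∏ i ∈ Finset.range r, ((b : ℝ) - 1) / ((b : ℝ) ^ (i + 1 + j) - 1) +
        (∏ i ∈ Finset.range n, ((b : ℝ) - 1) / ((b : ℝ) ^ (i + 1 + j) - 1)) *
          (((b : ℝ) ^ (n + j) - 1) / ((b : ℝ) ^ (n + j) - b)) := by
  have hb' : (2 : ℝ) ≤ b := by exact_mod_cast hb
  have hb0 : (0 : ℝ) < b := by linarith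
  induction n generalizing j with
  | zero =>
    obtain ⟨i, rfl⟩ := Nat.exists_eq_add_of_le' hj
    have hi : (1 : ℝ) < (b : ℝ) ^ i := one_lt_pow₀ (by linarith) (by omega)
    have h : ∀ m, (((b : ℝ) ^ (i + 1))⁻¹) ^ m * blockSum b 0 m = (((b : ℝ) ^ i)⁻¹) ^ m := by
      intro m
      rw [blockSum_zero_left, ← mul_pow]
      congr 1
      rw [pow_succ]
      field_simp
    rw [tsum_congr h, tsum_geometric_of_lt_one (by positivity) (inv_lt_one_of_one_lt₀ hi)]
    have h1 : (b : ℝ) ^ i - 1 ≠ 0 := by linarith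
    have h2 : (b : ℝ) ^ (i + 1) - b ≠ 0 := by
      rw [pow_succ, show (b : ℝ) ^ i * b - b = ((b : ℝ) ^ i - 1) * b by ring]
      exact mul_ne_zero h1 hb0.ne'
    have h3 : 1 - ((b : ℝ) ^ i)⁻¹ ≠ 0 := by
      have := inv_lt_one_of_one_lt₀ hi
      linarith
    simp only [Finset.range_zero, Finset.sum_empty, Finset.prod_empty, zero_add, one_mul]
    rw [← div_eq_mul_inv, div_eq_div_iff h3 h2, pow_succ]
    field_simp
  | succ n ih =>
    have hq : (1 : ℝ) < (b : ℝ) ^ (j + 1) := one_lt_pow₀ (by linarith) (by omega)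
    have hq1 : (b : ℝ) ^ (j + 1) - 1 ≠ 0 := by linarith
    have hq2 : ((b : ℝ) ^ (j + 1)) ≠ 0 := by positivity
    have h := ih (j + 1) (by omega) (by omega)
    set T := ∑' m, (((b : ℝ) ^ (j + 1))⁻¹) ^ m * blockSum b n m
    have hT : ((b : ℝ) - 1) * ((b : ℝ) ^ (j + 1))⁻¹ * T =
        ((b : ℝ) - 1) / ((b : ℝ) ^ (j + 1) - 1) * ((1 - ((b : ℝ) ^ (j + 1))⁻¹) * T) := by
      field_simp
    have e : ∀ i, i + 1 + (j + 1) = i + 1 + 1 + j := fun i => by ring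
    rw [tsum_blockSum_succ n j hb hj, hT, h, Finset.sum_range_succ']
    simp only [Finset.prod_range_succ', Finset.prod_range_zero, ← Finset.sum_mul, e]
    rw [show n + (j + 1) = n + 1 + j by ring, show 0 + 1 + j = j + 1 by ring]
    ring

lemma blockSum_eq {b : ℕ} (n m : ℕ) (hb : 2 ≤ b) :
    blockSum b (n + 1) m = 1 + ((b : ℝ) - 1) * (b : ℝ)⁻¹ *
      ∑ i ∈ Finset.range m, (((b : ℝ) ^ 1)⁻¹) ^ i * blockSum b n i := by
  induction m with
  | zero => simp [blockSum_zero_right]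
  | succ m ih =>
    rw [blockSum_succ n m hb, ih, Finset.sum_range_succ]
    simp only [pow_succ, mul_inv, inv_pow, pow_zero, one_mul]
    ring

lemma hasSum_ralpha {b : ℕ} (n : ℕ) (hb : 2 ≤ b) :
    HasSum (ralpha b (n + 2)) (1 + (1 - ((b : ℝ) ^ 1)⁻¹) *
      ∑' m, (((b : ℝ) ^ 1)⁻¹) ^ m * blockSum b (n + 1) m) := by
  have hb' : (2 : ℝ) ≤ b := by exact_mod_cast hb
  have hs := summable_blockSum (n + 1) 1 hb le_rfl (by omega)
  have hc : ((b : ℝ) - 1) * (b : ℝ)⁻¹ = 1 - ((b : ℝ) ^ 1)⁻¹ := by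
    field_simp
  have hlim : Filter.Tendsto (blockSum b (n + 2)) Filter.atTop (nhds (1 +
      (1 - ((b : ℝ) ^ 1)⁻¹) * ∑' m, (((b : ℝ) ^ 1)⁻¹) ^ m * blockSum b (n + 1) m)) := by
    have h := (hs.hasSum.tendsto_sum_nat.const_mul (1 - ((b : ℝ) ^ 1)⁻¹)).const_add 1
    refine h.congr fun m => ?_
    rw [blockSum_eq (n + 1) m hb, hc]
  have hmono : Monotone (blockSum b (n + 2)) := fun m m' hm =>
    Finset.sum_le_sum_of_subset_of_nonneg
      (Finset.range_subset_range.2 (Nat.pow_le_pow_right (by omega) hm))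
      fun _ _ _ => ralpha_nonneg _ _ _
  have hsum : Summable (ralpha b (n + 2)) := by
    refine summable_of_sum_range_le (ralpha_nonneg b (n + 2)) fun N =>
      le_trans ?_ (hmono.ge_of_tendsto hlim N)
    exact Finset.sum_le_sum_of_subset_of_nonneg
      (Finset.range_subset_range.2 (Nat.lt_pow_self (by omega : 1 < b)).le)
      fun _ _ _ => ralpha_nonneg _ _ _
  have ht := hsum.hasSum.tendsto_sum_nat.comp
    (tendsto_pow_atTop_atTop_of_one_lt (by omega : 1 < b))
  rw [tendsto_nhds_unique hlim ht]
  exact hsum.hasSum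

lemma wal_zero_right (b k : ℕ) : wal b k 0 = 1 := by
  simp [wal, xdigit]

/-- `ω_α(0) = ∑_{k=1}^∞ r_α(k) = ∑_{r=1}^{α-1} ∏_{i=1}^r (b-1)/(b^i-1)
      + (b-1)/(b^α - b) · ∏_{i=1}^{α-1} (b-1)/(b^i-1)`,
and in particular the series `∑_{k ≥ 1} r_α(k)` converges. -/
theorem stmt5 (b α : ℕ) (hb : 2 ≤ b) (hα : 2 ≤ α) :
    Summable (fun k : ℕ => ralpha b α (k + 1)) ∧
    omegaF b α 0 =
      ((∑ r ∈ Finset.range (α - 1), ∏ i ∈ Finset.range (r + 1),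
          ((b : ℝ) - 1) / ((b : ℝ) ^ (i + 1) - 1) +
        ((b : ℝ) - 1) / ((b : ℝ) ^ α - b) *
          ∏ i ∈ Finset.range (α - 1), ((b : ℝ) - 1) / ((b : ℝ) ^ (i + 1) - 1) : ℝ) : ℂ) := by
  obtain ⟨n, rfl⟩ := Nat.exists_eq_add_of_le' hα
  have hb' : (2 : ℝ) ≤ b := by exact_mod_cast hb
  have h := hasSum_ralpha n hb
  have hs : Summable fun k : ℕ => ralpha b (n + 2) (k + 1) :=
    (summable_nat_add_iff 1).2 h.summable
  refine ⟨hs, ?_⟩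
  have ht := h.summable.tsum_eq_zero_add
  rw [h.tsum_eq, ralpha_zero_right, tsum_blockSum (n + 1) 1 hb le_rfl (by omega)] at ht
  simp only [omegaF, wal_zero_right, mul_one]
  rw [← Complex.ofReal_tsum, ← add_left_cancel ht]
  congr 1
  have hb1 : ((b : ℝ) - 1) / ((b : ℝ) ^ (0 + 1) - 1) = 1 := by
    rw [zero_add, pow_one, div_self (by linarith)]
  have hp : ∀ r, ∏ i ∈ Finset.range (r + 1), ((b : ℝ) - 1) / ((b : ℝ) ^ (i + 1) - 1) =
      ∏ i ∈ Finset.range r, ((b : ℝ) - 1) / ((b : ℝ) ^ (i + 1 + 1) - 1) := by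
    intro r
    rw [Finset.prod_range_succ', hb1, mul_one]
  have hq : (b : ℝ) ^ (n + 1 + 1) - 1 ≠ 0 := by
    have : (1 : ℝ) < (b : ℝ) ^ (n + 1 + 1) := one_lt_pow₀ (by linarith) (by omega)
    linarith
  simp only [Nat.add_succ_sub_one, hp]
  rw [Finset.prod_range_succ]
  field_simp
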